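/- arXiv:1507.08082 — 2 statements merged into one kernel-verified Lean document; each statement's English description precedes it below -/
import Mathlib

section
/- Let G = (N, L) be a finite strongly connected directed graph, M ⊆ L, U = L \ M, and suppose a link e ∈ U belongs to an undirected cycle consisting entirely of links from U. Then there exist two flows f¹ and f², both with strictly positive value on every link, that agree on every link of M but satisfy f¹(e) ≠ f²(e). -/
open Finset

/-- A flow on a directed graph (given by `tail`/`head` maps on links) is a real-valued
function on links satisfying conservation at every node: total flow on links with head `n`
equals total flow on links with tail `n`. -/
def IsFlow {N L : Type} [Fintype L] [DecidableEq N]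
    (tail head : L → N) (f : L → ℝ) : Prop :=
  ∀ n : N, ∑ l ∈ Finset.univ.filter (fun l => head l = n), f l
         = ∑ l ∈ Finset.univ.filter (fun l => tail l = n), f l

/-- A directed graph is strongly connected if for every ordered pair of nodes there is a
directed walk from the first to the second. -/
def StronglyConnected {N L : Type} (tail head : L → N) : Prop :=
  ∀ a b : N, ∃ (k : ℕ) (nodes : Fin (k + 1) → N) (links : Fin k → L),
    nodes 0 = a ∧ nodes (Fin.last k) = b ∧
    ∀ i : Fin k, tail (links i) = nodes i.castSucc ∧ head (links i) = nodes i.succ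

/-- `InUndirectedCycle tail head U e`: link `e` lies on an undirected cycle (a closed walk
with pairwise distinct links, directions ignored) all of whose links belong to `U`. -/
def InUndirectedCycle {N L : Type} (tail head : L → N) (U : Set L) (e : L) : Prop :=
  ∃ (k : ℕ) (links : Fin (k + 1) → L) (dir : Fin (k + 1) → Bool) (nodes : Fin (k + 2) → N),
    Function.Injective links ∧
    (∀ i, links i ∈ U) ∧
    nodes 0 = nodes (Fin.last (k + 1)) ∧
    (∀ i : Fin (k + 1),
      (tail (links i), head (links i)) =
        (if dir i then (nodes i.castSucc, nodes i.succ)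
          else (nodes i.succ, nodes i.castSucc))) ∧
    (∃ i, links i = e)

/-- The set `U` of links contains an undirected cycle. -/
def HasUndirectedCycleIn {N L : Type} (tail head : L → N) (U : Set L) : Prop :=
  ∃ e, InUndirectedCycle tail head U e

/-- Link `e` is identifiable from the measured set `M`: any two nonnegative flows that agree
on every link of `M` agree on `e`. -/
def Identifiable {N L : Type} [Fintype L] [DecidableEq N]
    (tail head : L → N) (M : Set L) (e : L) : Prop :=
  ∀ f g : L → ℝ, IsFlow tail head f → IsFlow tail head g →
    (∀ l, 0 ≤ f l) → (∀ l, 0 ≤ g l) →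
    (∀ l ∈ M, f l = g l) → f e = g e

/-- The net inflow of `f` at the node `n`. -/
def netInflow {N L : Type} [Fintype L] [DecidableEq N]
    (tail head : L → N) (f : L → ℝ) (n : N) : ℝ :=
  ∑ l, f l * ((if head l = n then 1 else 0) - (if tail l = n then 1 else 0))

theorem isFlow_iff_netInflow_eq_zero {N L : Type} [Fintype L] [DecidableEq N]
    (tail head : L → N) (f : L → ℝ) :
    IsFlow tail head f ↔ ∀ n, netInflow tail head f n = 0 := by
  refine forall_congr' fun n => ?_
  simp [netInflow, mul_sub, Finset.sum_sub_distrib, Finset.sum_filter, sub_eq_zero]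

theorem netInflow_add {N L : Type} [Fintype L] [DecidableEq N]
    (tail head : L → N) (f g : L → ℝ) (n : N) :
    netInflow tail head (fun l => f l + g l) n =
      netInflow tail head f n + netInflow tail head g n := by
  simp [netInflow, add_mul, Finset.sum_add_distrib]

theorem netInflow_const_mul {N L : Type} [Fintype L] [DecidableEq N]
    (tail head : L → N) (c : ℝ) (f : L → ℝ) (n : N) :
    netInflow tail head (fun l => c * f l) n = c * netInflow tail head f n := by
  simp [netInflow, Finset.mul_sum, mul_assoc]

theorem netInflow_sum {N L ι : Type} [Fintype L] [DecidableEq N] [Fintype ι]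
    (tail head : L → N) (f : ι → L → ℝ) (n : N) :
    netInflow tail head (fun l => ∑ i, f i l) n = ∑ i, netInflow tail head (f i) n := by
  simp only [netInflow, Finset.sum_mul]
  exact Finset.sum_comm

theorem netInflow_single {N L : Type} [Fintype L] [DecidableEq N] [DecidableEq L]
    (tail head : L → N) (c : ℝ) (a : L) (n : N) :
    netInflow tail head (fun l => if a = l then c else 0) n =
      c * ((if head a = n then 1 else 0) - (if tail a = n then 1 else 0)) := by
  simp [netInflow, ite_mul]

/-- The chain of a walk with signs `s` has boundary `end - start`. -/
theorem netInflow_walk {N L : Type} [Fintype L] [DecidableEq N] [DecidableEq L]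
    (tail head : L → N) {k : ℕ} (nodes : Fin (k + 1) → N) (links : Fin k → L) (s : Fin k → ℝ)
    (n : N)
    (h : ∀ i, s i * ((if head (links i) = n then 1 else 0) -
        (if tail (links i) = n then 1 else 0)) =
      (if nodes i.succ = n then 1 else 0) - (if nodes i.castSucc = n then 1 else 0)) :
    netInflow tail head (fun l => ∑ i, if links i = l then s i else 0) n =
      (if nodes (Fin.last k) = n then 1 else 0) - (if nodes 0 = n then 1 else 0) := by
  simp only [netInflow_sum, netInflow_single, h, Finset.sum_sub_distrib]
  have h₁ := Fin.sum_univ_succ fun i => if nodes i = n then (1 : ℝ) else 0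
  have h₂ := Fin.sum_univ_castSucc fun i => if nodes i = n then (1 : ℝ) else 0
  linarith

theorem StronglyConnected.exists_flow_through {N L : Type} [Fintype L] [DecidableEq N]
    [DecidableEq L] {tail head : L → N} (hsc : StronglyConnected tail head) (a : L) :
    ∃ f : L → ℝ, IsFlow tail head f ∧ (∀ l, 0 ≤ f l) ∧ 1 ≤ f a := by
  obtain ⟨k, nodes, links, h0, hlast, hstep⟩ := hsc (head a) (tail a)
  have hnonneg : ∀ l, (0 : ℝ) ≤ ∑ i, if links i = l then 1 else 0 := fun l =>
    Finset.sum_nonneg fun i _ => by split_ifs <;> norm_num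
  refine ⟨fun l => (∑ i, if links i = l then 1 else 0) + if a = l then 1 else 0, ?_, ?_, ?_⟩
  · rw [isFlow_iff_netInflow_eq_zero]
    intro n
    rw [netInflow_add, netInflow_single,
      netInflow_walk tail head nodes links (fun _ => 1) n (fun i => by simp [hstep i]), h0, hlast]
    ring
  · intro l
    have := hnonneg l
    dsimp only
    split_ifs <;> linarith
  · simp

theorem StronglyConnected.exists_flow_one_le {N L : Type} [Fintype L] [DecidableEq N]
    [DecidableEq L] {tail head : L → N} (hsc : StronglyConnected tail head) :
    ∃ f : L → ℝ, IsFlow tail head f ∧ ∀ l, 1 ≤ f l := by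
  choose F hF hnonneg hone using hsc.exists_flow_through
  refine ⟨fun l => ∑ a, F a l, ?_, fun l => (hone l).trans ?_⟩
  · rw [isFlow_iff_netInflow_eq_zero]
    intro n
    rw [netInflow_sum]
    exact Finset.sum_eq_zero fun a _ => (isFlow_iff_netInflow_eq_zero ..).1 (hF a) n
  · exact Finset.single_le_sum (f := fun a => F a l) (fun a _ => hnonneg a l) (Finset.mem_univ l)

/-- An undirected cycle carries a signed flow supported on its links. -/
theorem InUndirectedCycle.exists_flow {N L : Type} [Fintype L] [DecidableEq N]
    [DecidableEq L] {tail head : L → N} {U : Set L} {e : L}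
    (h : InUndirectedCycle tail head U e) :
    ∃ c : L → ℝ, IsFlow tail head c ∧ (∀ l ∉ U, c l = 0) ∧ c e ≠ 0 := by
  obtain ⟨k, links, dir, nodes, hinj, hU, hclosed, hstep, j, rfl⟩ := h
  refine ⟨fun l => ∑ i, if links i = l then (if dir i then 1 else -1) else 0, ?_, ?_, ?_⟩
  · rw [isFlow_iff_netInflow_eq_zero]
    intro n
    rw [netInflow_walk tail head nodes links (fun i => if dir i then 1 else -1) n, hclosed, sub_self]
    intro i
    have hi := hstep i
    cases hd : dir i <;> simp only [hd, Bool.false_eq_true, if_true, if_false, Prod.mk.injEq] at hi ⊢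
      <;> rw [hi.1, hi.2] <;> ring
  · intro l hl
    exact Finset.sum_eq_zero fun i _ => if_neg fun hi : links i = l => hl (hi ▸ hU i)
  · simp only [hinj.eq_iff, Finset.sum_ite_eq', Finset.mem_univ, if_true]
    split_ifs <;> norm_num

/-- **necessity.** In a strongly connected graph, if an unmeasured link `e`
belongs to an undirected cycle of unmeasured links, then there are two everywhere strictly
positive flows that agree on all measured links but differ on `e`. -/
theorem exists_distinct_flows_of_in_unmeasured_cycle
    {N L : Type} [Fintype N] [Fintype L] [DecidableEq N] [DecidableEq L]
    (tail head : L → N) (hsc : StronglyConnected tail head)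
    (M : Set L) (e : L) (he : e ∉ M)
    (hcyc : InUndirectedCycle tail head Mᶜ e) :
    ∃ f g : L → ℝ, IsFlow tail head f ∧ IsFlow tail head g ∧
      (∀ l, 0 < f l) ∧ (∀ l, 0 < g l) ∧
      (∀ l ∈ M, f l = g l) ∧ f e ≠ g e := by
  obtain ⟨p, hp, hp1⟩ := hsc.exists_flow_one_le
  obtain ⟨c, hc, hcM, hce⟩ := hcyc.exists_flow
  have hle : ∀ l, |c l| ≤ ∑ a, |c a| := fun l =>
    Finset.single_le_sum (f := fun a => |c a|) (fun a _ => abs_nonneg _) (Finset.mem_univ l)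
  set C : ℝ := 1 + ∑ a, |c a| with hC
  have hCp : ∀ l, |c l| < C * p l := fun l => by
    nlinarith [hle l, hp1 l, abs_nonneg (c l)]
  rw [isFlow_iff_netInflow_eq_zero] at hp hc
  refine ⟨fun l => C * p l, fun l => C * p l + c l, ?_, ?_, ?_, ?_, ?_, ?_⟩
  · rw [isFlow_iff_netInflow_eq_zero]
    intro n
    rw [netInflow_const_mul, hp, mul_zero]
  · rw [isFlow_iff_netInflow_eq_zero]
    intro n
    rw [netInflow_add, netInflow_const_mul, hp, hc, mul_zero, add_zero]
  · exact fun l => (abs_nonneg _).trans_lt (hCp l)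
  · intro l
    linarith [hCp l, neg_abs_le (c l)]
  · intro l hl
    simp [hcM l (fun h => h hl)]
  · simpa using hce
end

section
/- Let G = (N, L) be a finite strongly connected directed graph with |L| = l links and |N| = n nodes. Then the minimum cardinality of a set M ⊆ L of measured links such that every link of L \ M is identifiable from M equals l − (n − 1). Equivalently: every link of U = L \ M is identifiable from M if and only if U contains no undirected cycle, and the maximum size of a subset of L containing no undirected cycle is n − 1 (attained by spanning trees of the underlying undirected graph). -/
open Finset

/-- The incidence vector of a link: `+1` at its head and `-1` at its tail (`0` for a loop). -/
noncomputable def incidenceVec {N L : Type} [DecidableEq N] (tail head : L → N) (l : L) : N → ℝ :=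
  Pi.single (head l) 1 - Pi.single (tail l) 1

section

variable {N L : Type} {tail head : L → N}

/-- If every link of a finite set `U`, traversed in the direction given by `d`, can be continued
by a link of `U`, then `U` contains an undirected cycle. -/
lemma hasUndirectedCycleIn_of_continue [Finite L] {U : Set L} (d : L → Bool) (hne : U.Nonempty)
    (h : ∀ e ∈ U, ∃ e' ∈ U, (if d e' then tail e' else head e') = if d e then head e else tail e) :
    HasUndirectedCycleIn tail head U := by
  choose! next hnextU hnext using h
  obtain ⟨e₀, he₀⟩ := hne
  have hiter : ∀ j, next^[j] e₀ ∈ U := fun j => by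
    induction j with
    | zero => exact he₀
    | succ j ih => rw [Function.iterate_succ_apply']; exact hnextU _ ih
  obtain ⟨a, b, hab, heq⟩ : ∃ a b, a < b ∧ next^[a] e₀ = next^[b] e₀ := by
    obtain ⟨a, b, hne, heq⟩ := Finite.exists_ne_map_eq_of_infinite fun j : ℕ => next^[j] e₀
    rcases lt_or_gt_of_ne hne with h | h
    exacts [⟨a, b, h, heq⟩, ⟨b, a, h, heq.symm⟩]
  set e := next^[a] e₀ with he
  have heU : ∀ j, next^[j] e ∈ U := fun j => by
    rw [he, ← Function.iterate_add_apply]; exact hiter _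
  have hper : e ∈ Function.periodicPts next := by
    refine ⟨b - a, by omega, ?_⟩
    rw [Function.IsPeriodicPt, Function.IsFixedPt, he, ← Function.iterate_add_apply,
      Nat.sub_add_cancel hab.le, ← heq]
  obtain ⟨k, hk⟩ := Nat.exists_eq_succ_of_ne_zero
    (Function.minimalPeriod_pos_of_mem_periodicPts hper).ne'
  have hclose : next^[k + 1] e = e := by
    simpa [hk] using Function.iterate_minimalPeriod (f := next) (x := e)
  let start : L → N := fun l => if d l then tail l else head l
  refine ⟨e, k, fun i => next^[i] e, fun i => d (next^[i] e), fun i => start (next^[i] e),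
    fun i j hij => ?_, fun i => heU i, by simp [hclose], fun i => ?_, 0, rfl⟩
  · have := (Function.iterate_eq_iterate_iff_of_lt_minimalPeriod (f := next) (x := e)
      (by rw [hk]; exact i.2) (by rw [hk]; exact j.2)).1 hij
    exact Fin.ext this
  · have := hnext _ (heU i)
    rw [← Function.iterate_succ_apply' next] at this
    simp only [Fin.val_castSucc, Fin.val_succ, start, Nat.succ_eq_add_one] at this ⊢
    rw [this]
    split_ifs <;> rfl

variable [DecidableEq N]

lemma isFlow_iff_sum_smul_incidenceVec [Fintype L] {f : L → ℝ} :
    IsFlow tail head f ↔ ∑ l, f l • incidenceVec tail head l = 0 := by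
  simp only [IsFlow, funext_iff, Finset.sum_apply, Pi.smul_apply, incidenceVec, Pi.sub_apply,
    Pi.single_apply, smul_eq_mul, mul_sub, mul_ite, mul_one, mul_zero, Finset.sum_sub_distrib,
    Pi.zero_apply, sub_eq_zero, Finset.sum_filter, eq_comm (b := tail _), eq_comm (b := head _)]

lemma IsFlow.add [Fintype L] {f g : L → ℝ} (hf : IsFlow tail head f) (hg : IsFlow tail head g) :
    IsFlow tail head (f + g) := by
  rw [isFlow_iff_sum_smul_incidenceVec] at *
  simp [add_smul, Finset.sum_add_distrib, hf, hg]

lemma IsFlow.smul [Fintype L] {f : L → ℝ} (c : ℝ) (hf : IsFlow tail head f) :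
    IsFlow tail head (c • f) := by
  rw [isFlow_iff_sum_smul_incidenceVec] at *
  simp [mul_smul, ← Finset.smul_sum, hf]

lemma IsFlow.sub [Fintype L] {f g : L → ℝ} (hf : IsFlow tail head f) (hg : IsFlow tail head g) :
    IsFlow tail head (f - g) := by
  simpa [sub_eq_add_neg] using hf.add (hg.smul (-1))

lemma isFlow_sum [Fintype L] {ι : Type} (s : Finset ι) {f : ι → L → ℝ}
    (hf : ∀ i ∈ s, IsFlow tail head (f i)) : IsFlow tail head (∑ i ∈ s, f i) :=
  Finset.sum_induction f (IsFlow tail head) (fun _ _ => IsFlow.add)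
    (by simp [isFlow_iff_sum_smul_incidenceVec]) hf

lemma Fin.sum_succ_sub_castSucc {A : Type*} [AddCommGroup A] {k : ℕ} (g : Fin (k + 1) → A) :
    ∑ i : Fin k, (g i.succ - g i.castSucc) = g (Fin.last k) - g 0 := by
  have h := (Fin.sum_univ_succ g).symm.trans (Fin.sum_univ_castSucc g)
  rw [Finset.sum_sub_distrib, sub_eq_sub_iff_add_eq_add, add_comm, h, add_comm]

lemma sum_sum_ite_smul [Fintype L] [DecidableEq L] {A : Type*} [AddCommGroup A] [Module ℝ A]
    {k : ℕ} (links : Fin k → L) (s : Fin k → ℝ) (v : L → A) :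
    ∑ l, (∑ i, if links i = l then s i else 0) • v l = ∑ i, s i • v (links i) := by
  simp only [Finset.sum_smul, ite_smul, zero_smul]
  rw [Finset.sum_comm]
  simp

/-- The incidence vectors along a directed walk telescope. -/
lemma sum_incidenceVec_walk {k : ℕ} {nodes : Fin (k + 1) → N} {links : Fin k → L}
    (h : ∀ i : Fin k, tail (links i) = nodes i.castSucc ∧ head (links i) = nodes i.succ) :
    ∑ i, incidenceVec tail head (links i) =
      Pi.single (nodes (Fin.last k)) 1 - Pi.single (nodes 0) 1 := by
  rw [← Fin.sum_succ_sub_castSucc fun i => (Pi.single (nodes i) 1 : N → ℝ)]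
  simp [incidenceVec, h]

lemma exists_flow_pos_at [Fintype L] [DecidableEq L] (hsc : StronglyConnected tail head) (e : L) :
    ∃ f : L → ℝ, IsFlow tail head f ∧ (∀ l, 0 ≤ f l) ∧ 1 ≤ f e := by
  obtain ⟨k, nodes, links, h0, h1, h⟩ := hsc (head e) (tail e)
  have hnn : ∀ l, (0 : ℝ) ≤ ∑ i, if links i = l then (1 : ℝ) else 0 := fun l =>
    Finset.sum_nonneg fun i _ => by split_ifs <;> norm_num
  refine ⟨(fun l => ∑ i, if links i = l then 1 else 0) + Pi.single e 1, ?_, fun l => ?_, ?_⟩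
  · rw [isFlow_iff_sum_smul_incidenceVec]
    simp only [Pi.add_apply, add_smul, Finset.sum_add_distrib, sum_sum_ite_smul, one_smul,
      sum_incidenceVec_walk h, h0, h1]
    simp [Pi.single_apply, incidenceVec]
  · exact add_nonneg (hnn l) (by rw [Pi.single_apply]; split_ifs <;> norm_num)
  · simp

lemma exists_flow_ge_one [Fintype L] [DecidableEq L] (hsc : StronglyConnected tail head) :
    ∃ f : L → ℝ, IsFlow tail head f ∧ ∀ l, 1 ≤ f l := by
  choose f hf hnn hpos using exists_flow_pos_at hsc
  refine ⟨∑ e, f e, isFlow_sum _ fun e _ => hf e, fun l => (hpos l).trans ?_⟩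
  rw [Finset.sum_apply]
  exact Finset.single_le_sum (f := fun e => f e l) (fun e _ => hnn e l) (Finset.mem_univ l)

lemma exists_flow_of_hasUndirectedCycleIn [Fintype L] [DecidableEq L] {U : Set L}
    (h : HasUndirectedCycleIn tail head U) :
    ∃ c : L → ℝ, IsFlow tail head c ∧ c ≠ 0 ∧ ∀ l ∉ U, c l = 0 := by
  obtain ⟨-, k, links, dir, nodes, hinj, hU, hclosed, hstep, -⟩ := h
  let s : Fin (k + 1) → ℝ := fun i => if dir i then 1 else -1
  refine ⟨fun l => ∑ i, if links i = l then s i else 0, ?_, fun h0 => ?_, fun l hl => ?_⟩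
  · rw [isFlow_iff_sum_smul_incidenceVec, sum_sum_ite_smul]
    calc ∑ i, s i • incidenceVec tail head (links i)
        = ∑ i : Fin (k + 1),
            ((Pi.single (nodes i.succ) 1 : N → ℝ) - Pi.single (nodes i.castSucc) 1) := by
          refine Finset.sum_congr rfl fun i _ => ?_
          have := hstep i
          cases hd : dir i <;> simp only [hd, Bool.false_eq_true, if_true, if_false,
            Prod.mk.injEq] at this <;> simp [s, hd, incidenceVec, this.1, this.2]
      _ = 0 := by
          rw [Fin.sum_succ_sub_castSucc fun i => (Pi.single (nodes i) 1 : N → ℝ), hclosed, sub_self]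
  · have := congrFun h0 (links 0)
    simp only [hinj.eq_iff, Finset.sum_ite_eq', Finset.mem_univ, if_true, Pi.zero_apply, s] at this
    split_ifs at this <;> norm_num at this
  · exact Finset.sum_eq_zero fun i _ => if_neg fun (h : links i = l) => hl (h ▸ hU i)

lemma hasUndirectedCycleIn_of_flow [Fintype L] {U : Set L} {c : L → ℝ}
    (hc : IsFlow tail head c) (hne : c ≠ 0) (hU : ∀ l ∉ U, c l = 0) :
    HasUndirectedCycleIn tail head U := by
  suffices h : HasUndirectedCycleIn tail head {l | c l ≠ 0} by
    obtain ⟨e, k, links, dir, nodes, hinj, hmem, hrest⟩ := h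
    exact ⟨e, k, links, dir, nodes, hinj, fun i => by_contra fun h => hmem i (hU _ h), hrest⟩
  refine hasUndirectedCycleIn_of_continue (fun l => decide (0 < c l))
    (Function.ne_iff.1 hne) fun e he => ?_
  by_contra! hcon
  simp only [decide_eq_true_eq, Set.mem_ofPred_eq] at hcon he
  have h0 := congrFun (isFlow_iff_sum_smul_incidenceVec.1 hc) (if 0 < c e then head e else tail e)
  have hself := hcon e he
  set n := if 0 < c e then head e else tail e with hn
  simp only [Finset.sum_apply, Pi.smul_apply, smul_eq_mul, Pi.zero_apply] at h0
  have hnn : ∀ l ∈ Finset.univ, 0 ≤ c l * incidenceVec tail head l n := fun l _ => by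
    rcases lt_trichotomy (c l) 0 with h | h | h
    · have := hcon l h.ne
      rw [if_neg h.not_gt] at this
      simp only [incidenceVec, Pi.sub_apply, Pi.single_apply, if_neg this.symm]
      split_ifs <;> linarith
    · simp [h]
    · have := hcon l h.ne'
      rw [if_pos h] at this
      simp only [incidenceVec, Pi.sub_apply, Pi.single_apply, if_neg this.symm]
      split_ifs <;> linarith
  have hz := (Finset.sum_eq_zero_iff_of_nonneg hnn).1 h0 e (Finset.mem_univ e)
  have hv := (mul_eq_zero.1 hz).resolve_left he
  rw [incidenceVec, Pi.sub_apply, Pi.single_apply, Pi.single_apply] at hv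
  split_ifs at hself hn <;> rw [hn] at hself hv <;> simp [hself.symm] at hv

lemma not_hasUndirectedCycleIn_iff_linearIndepOn [Fintype L] [DecidableEq L] {S : Finset L} :
    ¬ HasUndirectedCycleIn tail head (S : Set L) ↔
      LinearIndepOn ℝ (incidenceVec tail head) (S : Set L) := by
  rw [linearIndepOn_finset_iff]
  constructor
  · intro h f hf l hl
    by_contra hfl
    refine h (hasUndirectedCycleIn_of_flow (c := fun l => if l ∈ S then f l else 0) ?_
      (fun h0 => hfl ?_) fun l hl => if_neg hl)
    · simpa [isFlow_iff_sum_smul_incidenceVec] using hf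
    · simpa [hl] using congrFun h0 l
  · intro h hcyc
    obtain ⟨c, hc, hne, hU⟩ := exists_flow_of_hasUndirectedCycleIn hcyc
    refine hne (funext fun l => ?_)
    by_cases hl : l ∈ S
    · refine h c ?_ l hl
      rw [isFlow_iff_sum_smul_incidenceVec] at hc
      rw [← hc]
      exact Finset.sum_subset (Finset.subset_univ S) fun l _ hl => by simp [hU l hl]
    · exact hU l hl

lemma forall_identifiable_iff [Fintype L] [DecidableEq L] (hsc : StronglyConnected tail head)
    (M : Set L) :
    (∀ e ∉ M, Identifiable tail head M e) ↔ ¬ HasUndirectedCycleIn tail head Mᶜ := by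
  constructor
  · intro hid hcyc
    obtain ⟨c, hc, hne, hM⟩ := exists_flow_of_hasUndirectedCycleIn hcyc
    obtain ⟨p, hp, hp1⟩ := exists_flow_ge_one hsc
    obtain ⟨e, he⟩ := Function.ne_iff.1 hne
    have heM : e ∉ M := fun h => he (hM e (not_not.2 h))
    have hK : ∀ l, |c l| ≤ ∑ l, |c l| := fun l =>
      Finset.single_le_sum (f := fun l => |c l|) (fun l _ => abs_nonneg _) (Finset.mem_univ l)
    set K := ∑ l, |c l|
    have hbound : ∀ l, |c l| ≤ K * p l := fun l => by
      nlinarith [hK l, abs_nonneg (c l), hp1 l]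
    have := hid e heM (K • p) (K • p + c) (hp.smul K) ((hp.smul K).add hc)
      (fun l => (abs_nonneg _).trans (hbound l))
      (fun l => by
        have := neg_abs_le (c l)
        simp only [Pi.add_apply, Pi.smul_apply, smul_eq_mul]
        linarith [hbound l])
      (fun l hl => by simp [hM l (not_not.2 hl)])
    exact he (by simpa using this)
  · intro hcyc e _ f g hf hg _ _ hfg
    by_contra hne
    exact hcyc (hasUndirectedCycleIn_of_flow (hf.sub hg)
      (fun h => hne (sub_eq_zero.1 (congrFun h e)))
      fun l hl => sub_eq_zero.2 (hfg l (not_not.1 hl)))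

lemma finrank_span_incidenceVec [Fintype N] (hsc : StronglyConnected tail head) :
    Module.finrank ℝ (Submodule.span ℝ (Set.range (incidenceVec tail head))) =
      Fintype.card N - 1 := by
  set W := Submodule.span ℝ (Set.range (incidenceVec tail head))
  rcases isEmpty_or_nonempty N with hN | ⟨⟨a⟩⟩
  · simpa using W.finrank_le
  have hlt : W < ⊤ := by
    let φ : (N → ℝ) →ₗ[ℝ] ℝ := ∑ n, LinearMap.proj n
    have hle : W ≤ LinearMap.ker φ := Submodule.span_le.2 <| by
      rintro _ ⟨l, rfl⟩
      simp [φ, incidenceVec]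
    refine lt_top_iff_ne_top.2 fun h => ?_
    have : φ (Pi.single a 1) = 0 := hle (h ▸ Submodule.mem_top)
    simp [φ] at this
  have hsup : W ⊔ Submodule.span ℝ {Pi.single a 1} = ⊤ := by
    rw [eq_top_iff, ← (Pi.basisFun ℝ N).span_eq, Submodule.span_le]
    rintro _ ⟨b, rfl⟩
    obtain ⟨k, nodes, links, h0, h1, h⟩ := hsc a b
    have hmem : (Pi.single b 1 - Pi.single a 1 : N → ℝ) ∈ W := by
      rw [← h0, ← h1, ← sum_incidenceVec_walk h]
      exact Submodule.sum_mem _ fun i _ => Submodule.subset_span ⟨_, rfl⟩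
    rw [Pi.basisFun_apply]
    exact Submodule.mem_sup.2 ⟨_, hmem, _, Submodule.mem_span_singleton_self _, sub_add_cancel _ _⟩
  have h1 := Submodule.finrank_lt hlt.ne
  have h2 := Submodule.finrank_add_le_finrank_add_finrank W (Submodule.span ℝ {Pi.single a 1})
  have h3 := finrank_span_le_card (R := ℝ) ({Pi.single a 1} : Set (N → ℝ))
  rw [hsup, finrank_top] at h2
  simp only [Module.finrank_fintype_fun_eq_card, Set.toFinset_singleton,
    Finset.card_singleton] at h1 h2 h3
  omega

lemma isGreatest_card_of_not_hasUndirectedCycleIn [Fintype N] [Fintype L] [DecidableEq L]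
    (hsc : StronglyConnected tail head) :
    IsGreatest {k : ℕ | ∃ S : Finset L, S.card = k ∧
        ¬ HasUndirectedCycleIn tail head (S : Set L)} (Fintype.card N - 1) := by
  rw [← finrank_span_incidenceVec hsc]
  constructor
  · obtain ⟨κ, a, ha, hspan, hli⟩ := exists_linearIndependent' ℝ (incidenceVec tail head)
    have : Finite κ := Finite.of_injective a ha
    have := Fintype.ofFinite κ
    refine ⟨Finset.univ.image a, ?_, ?_⟩
    · rw [Finset.card_image_of_injective _ ha, ← hspan, finrank_span_eq_card hli,
        Finset.card_univ]
    · rw [not_hasUndirectedCycleIn_iff_linearIndepOn, Finset.coe_image, Finset.coe_univ,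
        Set.image_univ]
      exact (linearIndepOn_range_iff ha _).2 hli
  · rintro _ ⟨S, rfl, hS⟩
    rw [not_hasUndirectedCycleIn_iff_linearIndepOn] at hS
    have h := finrank_span_eq_card (show LinearIndependent ℝ
      fun l : S => incidenceVec tail head l from hS)
    rw [Fintype.card_coe] at h
    rw [← h]
    exact Submodule.finrank_mono (Submodule.span_mono (by rintro _ ⟨l, rfl⟩; exact ⟨l, rfl⟩))

end

/-- In a finite strongly connected directed graph with `l` links and `n`
nodes, the minimum cardinality of a measured set `M` making every unmeasured link
identifiable is `l - (n - 1)`.  Equivalently: all links of `L \ M` are identifiable from `M`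
iff `L \ M` contains no undirected cycle, and the maximum size of a subset of links
containing no undirected cycle is `n - 1`. -/
theorem min_measurements_eq_links_sub_nodes_sub_one
    {N L : Type} [Fintype N] [Fintype L] [DecidableEq N] [DecidableEq L]
    (tail head : L → N) (hsc : StronglyConnected tail head) :
    IsLeast {k : ℕ | ∃ M : Finset L, M.card = k ∧
        ∀ e ∉ M, Identifiable tail head ↑M e}
      (Fintype.card L - (Fintype.card N - 1))
    ∧ (∀ M : Finset L,
        (∀ e ∉ M, Identifiable tail head ↑M e) ↔
          ¬ HasUndirectedCycleIn tail head (↑M : Set L)ᶜ)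
    ∧ IsGreatest {k : ℕ | ∃ S : Finset L, S.card = k ∧
        ¬ HasUndirectedCycleIn tail head (↑S : Set L)}
      (Fintype.card N - 1) := by
  refine ⟨?_, fun M => forall_identifiable_iff hsc _,
    isGreatest_card_of_not_hasUndirectedCycleIn hsc⟩
  obtain ⟨⟨S, hS, hcyc⟩, hmax⟩ := isGreatest_card_of_not_hasUndirectedCycleIn hsc
  constructor
  · refine ⟨Sᶜ, by rw [Finset.card_compl, hS], ?_⟩
    have := (forall_identifiable_iff hsc (↑Sᶜ : Set L)).2 (by simpa using hcyc)
    exact fun e he => this e (by simpa using he)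
  · rintro _ ⟨M, rfl, hM⟩
    have hle := hmax ⟨Mᶜ, rfl, by simpa using (forall_identifiable_iff hsc (M : Set L)).1 hM⟩
    rw [Finset.card_compl] at hle
    omega
end
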